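/- arXiv:1403.2395 — 2 statements merged into one kernel-verified Lean document; each statement's English description precedes it below -/
import Mathlib

section
/- For 0 ≤ i < j ≤ N and α ∈ H_j, one has α ∈ P^{i,j} if and only if there exist elements α_ℓ ∈ W_ℓ for ℓ = i, …, j−1 such that f_ℓ(α_ℓ) = α_{ℓ+1} for ℓ = i, …, j−2 and f_{j−1}(α_{j−1}) = α. -/
/-!
Setting: a field `k`, finite-dimensional `k`-vector spaces `H 0, …, H N` with
linear maps `f i : H i → H (i+1)`, and for each `i` a linear map
`Δ i : H i → T i`.

`compF f i d : H i →ₗ H (i+d)` is the composite `f^{i,i+d}`.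
`pers f Δ i d` is the `Δ`-persistent group
`P^{i,i+d} = f^{i,i+d}( ⋂_{e=0}^{d} ker (Δ_{i+e} ∘ f^{i,i+e}) ) ⊆ H (i+d)`.
`Wsub f Δ ℓ = ker Δ_ℓ ⊓ ker (Δ_{ℓ+1} ∘ f_ℓ) ⊆ H ℓ`.
-/

variable (k : Type*) [Field k]
variable (H : ℕ → Type*) [∀ i, AddCommGroup (H i)] [∀ i, Module k (H i)]
  [∀ i, FiniteDimensional k (H i)]
variable (T : ℕ → Type*) [∀ i, AddCommGroup (T i)] [∀ i, Module k (T i)]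

/-- The composite `f^{i,i+d} : H i →ₗ[k] H (i+d)`. -/
def compF (f : ∀ i, H i →ₗ[k] H (i + 1)) (i : ℕ) : (d : ℕ) → H i →ₗ[k] H (i + d)
  | 0 => LinearMap.id
  | d + 1 => (f (i + d)).comp (compF f i d)

/-- The `Δ`-persistent group `P^{i,i+d}`. -/
def pers (f : ∀ i, H i →ₗ[k] H (i + 1)) (Δ : ∀ i, H i →ₗ[k] T i) (i d : ℕ) :
    Submodule k (H (i + d)) :=
  Submodule.map (compF k H f i d)
    (⨅ e : Fin (d + 1), LinearMap.ker ((Δ (i + (e : ℕ))).comp (compF k H f i (e : ℕ))))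

/-- `W_ℓ = ker Δ_ℓ ⊓ ker (Δ_{ℓ+1} ∘ f_ℓ)`. -/
def Wsub (f : ∀ i, H i →ₗ[k] H (i + 1)) (Δ : ∀ i, H i →ₗ[k] T i) (ℓ : ℕ) :
    Submodule k (H ℓ) :=
  LinearMap.ker (Δ ℓ) ⊓ LinearMap.ker ((Δ (ℓ + 1)).comp (f ℓ))

theorem compF_eq_of_chain (f : ∀ i, H i →ₗ[k] H (i + 1)) (i d : ℕ) (a : ∀ e : ℕ, H (i + e))
    (ha : ∀ e, e < d → f (i + e) (a e) = a (e + 1)) :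
    ∀ e, e ≤ d → compF k H f i e (a 0) = a e
  | 0, _ => rfl
  | e + 1, he => by
    change f (i + e) (compF k H f i e (a 0)) = a (e + 1)
    rw [compF_eq_of_chain f i d a ha e (by omega), ha e (by omega)]

theorem mem_pers_iff (f : ∀ i, H i →ₗ[k] H (i + 1)) (Δ : ∀ i, H i →ₗ[k] T i) (i d : ℕ)
    (α : H (i + d)) :
    α ∈ pers k H T f Δ i d ↔
      ∃ x : H i, (∀ e, e ≤ d → Δ (i + e) (compF k H f i e x) = 0) ∧ compF k H f i d x = α := by
  simp only [pers, Submodule.mem_map, Submodule.mem_iInf, LinearMap.mem_ker,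
    LinearMap.comp_apply, Fin.forall_iff, Nat.lt_succ_iff]

/-- for `0 ≤ i < j ≤ N` (`j = i + d + 1`) and `α ∈ H j`, one has
`α ∈ P^{i,j}` iff there are `α_ℓ ∈ W_ℓ`, `ℓ = i, …, j-1`, with
`f_ℓ α_ℓ = α_{ℓ+1}` for `ℓ = i, …, j-2` and `f_{j-1} α_{j-1} = α`. -/
theorem mem_pers_iff_chain
    (N : ℕ) (f : ∀ i, H i →ₗ[k] H (i + 1)) (Δ : ∀ i, H i →ₗ[k] T i) :
    ∀ i d : ℕ, i + d + 1 ≤ N → ∀ α : H (i + (d + 1)),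
      α ∈ pers k H T f Δ i (d + 1) ↔
        ∃ a : ∀ e : ℕ, H (i + e),
          (∀ e, e ≤ d → a e ∈ Wsub k H T f Δ (i + e)) ∧
          (∀ e, e < d → f (i + e) (a e) = a (e + 1)) ∧
          f (i + d) (a d) = α := by
  intro i d _ α
  rw [mem_pers_iff]
  constructor
  · rintro ⟨x, hx, rfl⟩
    exact ⟨fun e => compF k H f i e x,
      fun e he => ⟨hx e (by omega), hx (e + 1) (by omega)⟩, fun _ _ => rfl, rfl⟩
  · rintro ⟨a, haW, hchain, rfl⟩
    have hcomp := compF_eq_of_chain k H f i d a hchain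
    have hlast : compF k H f i (d + 1) (a 0) = f (i + d) (a d) :=
      congrArg (f (i + d)) (hcomp d le_rfl)
    refine ⟨a 0, fun e he => ?_, hlast⟩
    rcases Nat.le_succ_iff.mp he with he | rfl
    · rw [hcomp e he]
      exact (haW e he).1
    · rw [hlast]
      exact (haW d le_rfl).2
end

section
/- Let (C, d) be a chain complex of vector spaces over a field k, and let H denote its homology regarded as a chain complex with zero differential (H_n = H_n(C) for each n). Then there exist chain maps p : (C, d) → (H, 0) and ι : (H, 0) → (C, d) and a family of linear maps φ_n : C_n → C_{n+1} such that p ∘ ι = id_H, p ∘ φ = 0, φ ∘ ι = 0, φ ∘ φ = 0, and φ d + d φ = ι p − id_C; i.e., (C, d) admits a transfer diagram onto its homology. -/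
/-!
Setting: a field `k` and a ℤ-indexed chain complex `(C, d)` of `k`-vector
spaces, with `d n : C n →ₗ[k] C (n-1)` and `d ∘ d = 0`.

`Hlgy k C d n = ker (d n) / im (d (n+1))` is the homology of `(C, d)` in degree
`n`, regarded (with zero differential) as the target of the transfer diagram.
`castL` is the canonical linear isomorphism `C n ≃ₗ C m` induced by an equality
`n = m` of degrees.
-/

variable (k : Type*) [Field k]
variable (C : ℤ → Type*) [∀ n, AddCommGroup (C n)] [∀ n, Module k (C n)]

/-- The canonical isomorphism `C n ≃ₗ[k] C m` induced by an equality `n = m`. -/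
def castL {n m : ℤ} (h : n = m) : C n ≃ₗ[k] C m := by
  subst h; exact LinearEquiv.refl k (C n)

/-- The boundaries `im (d (n+1)) ⊆ C n`. -/
def bdries (d : ∀ n, C n →ₗ[k] C (n - 1)) (n : ℤ) : Submodule k (C n) :=
  LinearMap.range ((castL k C (show n + 1 - 1 = n by omega)).toLinearMap ∘ₗ d (n + 1))

/-- The homology `H n = ker (d n) / im (d (n+1))` of the complex `(C, d)`. -/
abbrev Hlgy (d : ∀ n, C n →ₗ[k] C (n - 1)) (n : ℤ) :=
  ↥(LinearMap.ker (d n)) ⧸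
    Submodule.comap (LinearMap.ker (d n)).subtype (bdries k C d n)

variable {k C} in
/-- The differential `C (n + 1) → C n`, with its target transported along `n + 1 - 1 = n`. -/
def dFromSucc (d : ∀ n, C n →ₗ[k] C (n - 1)) (n : ℤ) : C (n + 1) →ₗ[k] C n :=
  (castL k C (show n + 1 - 1 = n by omega)).toLinearMap ∘ₗ d (n + 1)

variable {k C} in
theorem d_castL_d (d : ∀ n, C n →ₗ[k] C (n - 1)) (hdd : ∀ n, (d (n - 1)) ∘ₗ (d n) = 0)
    {n m : ℤ} (h : n - 1 = m) (x : C n) : d m (castL k C h (d n x)) = 0 := by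
  subst h
  exact LinearMap.congr_fun (hdd n) x

variable {k C} in
theorem d_dFromSucc (d : ∀ n, C n →ₗ[k] C (n - 1)) (hdd : ∀ n, (d (n - 1)) ∘ₗ (d n) = 0)
    (n : ℤ) (x : C (n + 1)) : d n (dFromSucc d n x) = 0 :=
  d_castL_d d hdd _ x

variable {k C} in
theorem dFromSucc_eq_zero_iff (d : ∀ n, C n →ₗ[k] C (n - 1)) (n : ℤ) (x : C (n + 1)) :
    dFromSucc d n x = 0 ↔ d (n + 1) x = 0 :=
  (castL k C (show n + 1 - 1 = n by omega)).map_eq_zero_iff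

variable {k C} in
/-- An identity for `φ ∘ d` on `C (m + 1)` gives the same identity on `C n` when `m + 1 = n`. -/
theorem castL_comp_d_of_dFromSucc (d : ∀ n, C n →ₗ[k] C (n - 1))
    (φ : ∀ n, C n →ₗ[k] C (n + 1)) (ψ : ∀ n, C n →ₗ[k] C n)
    (hφ : ∀ n x, φ n (dFromSucc d n x) = ψ (n + 1) x)
    {n m : ℤ} (h : n - 1 = m) (h' : m + 1 = n) (x : C n) :
    castL k C h' (φ m (castL k C h (d n x))) = ψ n x := by
  subst h'
  exact hφ m x

variable {k C} in
theorem castL_d_mem_bdries (d : ∀ n, C n →ₗ[k] C (n - 1)) {n m : ℤ} (h : n - 1 = m) (x : C n) :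
    castL k C h (d n x) ∈ bdries k C d m := by
  obtain rfl : n = m + 1 := by omega
  exact ⟨x, rfl⟩

/-- A linear map over a field has a generalized inverse. -/
theorem LinearMap.exists_comp_comp_eq_self {K V W : Type*} [Field K] [AddCommGroup V] [Module K V]
    [AddCommGroup W] [Module K W] (f : V →ₗ[K] W) :
    ∃ g : W →ₗ[K] V, ∀ x, f (g (f x)) = f x := by
  obtain ⟨s, hs⟩ := f.rangeRestrict.exists_rightInverse_of_surjective f.range_rangeRestrict
  obtain ⟨t, ht⟩ := (LinearMap.range f).subtype.exists_leftInverse_of_injective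
    (LinearMap.range f).ker_subtype
  refine ⟨s ∘ₗ t, fun x => ?_⟩
  have h₁ : t (f x) = f.rangeRestrict x := LinearMap.congr_fun ht (f.rangeRestrict x)
  have h₂ := congrArg Subtype.val (LinearMap.congr_fun hs (f.rangeRestrict x))
  simpa [h₁] using h₂

/-- every chain complex `(C, d)` of vector spaces over a field
admits a transfer diagram onto its homology `(H, 0)`: chain maps
`p : (C, d) → (H, 0)` and `ι : (H, 0) → (C, d)` and a degree `+1` map
`φ : C n → C (n+1)` with `p ι = id`, `p φ = 0`, `φ ι = 0`, `φ² = 0` and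
`φ d + d φ = ι p - id`. -/
theorem exists_transfer_diagram
    (d : ∀ n, C n →ₗ[k] C (n - 1))
    (hdd : ∀ n, (d (n - 1)) ∘ₗ (d n) = 0) :
    ∃ (p : ∀ n, C n →ₗ[k] Hlgy k C d n)
      (ι : ∀ n, Hlgy k C d n →ₗ[k] C n)
      (φ : ∀ n, C n →ₗ[k] C (n + 1)),
      -- `p` is a chain map `(C, d) → (H, 0)`
      (∀ n, (p (n - 1)) ∘ₗ (d n) = 0) ∧
      -- `ι` is a chain map `(H, 0) → (C, d)`
      (∀ n, (d n) ∘ₗ (ι n) = 0) ∧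
      -- `p ∘ ι = id`
      (∀ n, (p n) ∘ₗ (ι n) = LinearMap.id) ∧
      -- `p ∘ φ = 0`
      (∀ n, (p (n + 1)) ∘ₗ (φ n) = 0) ∧
      -- `φ ∘ ι = 0`
      (∀ n, (φ n) ∘ₗ (ι n) = 0) ∧
      -- `φ ∘ φ = 0`
      (∀ n, (φ (n + 1)) ∘ₗ (φ n) = 0) ∧
      -- `φ d + d φ = ι p - id`
      (∀ n,
        (castL k C (show n - 1 + 1 = n by omega)).toLinearMap ∘ₗ (φ (n - 1)) ∘ₗ (d n) +
          (castL k C (show n + 1 - 1 = n by omega)).toLinearMap ∘ₗ (d (n + 1)) ∘ₗ (φ n) =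
        (ι n) ∘ₗ (p n) - LinearMap.id) := by
  choose r hr using fun n => (LinearMap.ker (d n)).subtype.exists_leftInverse_of_injective
    (LinearMap.ker (d n)).ker_subtype
  choose s hs using fun n => (Submodule.comap (LinearMap.ker (d n)).subtype
    (bdries k C d n)).mkQ.exists_rightInverse_of_surjective (Submodule.range_mkQ _)
  choose g hg using fun n => (dFromSucc d n).exists_comp_comp_eq_self
  let p : ∀ n, C n →ₗ[k] Hlgy k C d n := fun n => Submodule.mkQ _ ∘ₗ r n
  let ρ : ∀ n, C n →ₗ[k] C n := fun n => (LinearMap.ker (d n)).subtype ∘ₗ r n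
  let ι : ∀ n, Hlgy k C d n →ₗ[k] C n := fun n => (LinearMap.ker (d n)).subtype ∘ₗ s n
  -- The projection of `C n` onto the boundaries.
  let π : ∀ n, C n →ₗ[k] C n := fun n => ρ n - ι n ∘ₗ p n
  let φ : ∀ n, C n →ₗ[k] C (n + 1) := fun n => -((LinearMap.id - ρ (n + 1)) ∘ₗ g n ∘ₗ π n)
  have r_of_mem : ∀ n (z : LinearMap.ker (d n)), r n z = z :=
    fun n z => LinearMap.congr_fun (hr n) z
  have ρ_of_d : ∀ n x, d n x = 0 → ρ n x = x := fun n x hx =>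
    congrArg Subtype.val (r_of_mem n ⟨x, hx⟩)
  have d_ρ : ∀ n x, d n (ρ n x) = 0 := fun n x => (r n x).2
  have p_ρ : ∀ n x, p n (ρ n x) = p n x := fun n x =>
    congrArg (Submodule.mkQ _) (r_of_mem n (r n x))
  have d_ι : ∀ n y, d n (ι n y) = 0 := fun n y => (s n y).2
  have p_ι : ∀ n y, p n (ι n y) = y := fun n y =>
    (congrArg _ (r_of_mem n (s n y))).trans (LinearMap.congr_fun (hs n) y)
  have p_bdry : ∀ n x, x ∈ bdries k C d n → d n x = 0 → p n x = 0 := fun n x hx hdx => by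
    refine (congrArg _ (r_of_mem n ⟨x, hdx⟩)).trans ?_
    exact (Submodule.Quotient.mk_eq_zero _).2 hx
  have π_mem : ∀ n x, ∃ y, dFromSucc d n y = π n x := fun n x => by
    have h : Submodule.mkQ (Submodule.comap (LinearMap.ker (d n)).subtype (bdries k C d n))
        (r n x - s n (p n x)) = 0 := by
      rw [map_sub]
      exact sub_eq_zero.2 (LinearMap.congr_fun (hs n) (p n x)).symm
    exact (Submodule.Quotient.mk_eq_zero _).1 h
  have π_d : ∀ n y, π n (dFromSucc d n y) = dFromSucc d n y := fun n y => by
    have h := d_dFromSucc d hdd n y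
    have h' : p n (dFromSucc d n y) = 0 := p_bdry n _ ⟨y, rfl⟩ h
    simp [π, ρ_of_d n _ h, h']
  have π_ι : ∀ n y, π n (ι n y) = 0 := fun n y => by
    simp [π, ρ_of_d n _ (d_ι n y), p_ι]
  have p_φ : ∀ n x, p (n + 1) (φ n x) = 0 := fun n x => by simp [φ, p_ρ]
  have ρ_φ : ∀ n x, ρ (n + 1) (φ n x) = 0 := fun n x => by
    simp [φ, ρ_of_d _ _ (d_ρ _ _)]
  have φ_of_π : ∀ n x, π n x = 0 → φ n x = 0 := fun n x hx => by simp [φ, hx]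
  have d_φ : ∀ n x, dFromSucc d n (φ n x) = -π n x := fun n x => by
    obtain ⟨y, hy⟩ := π_mem n x
    simp [φ, ← hy, hg, (dFromSucc_eq_zero_iff d n _).2 (d_ρ _ _)]
  have φ_d : ∀ n x, φ n (dFromSucc d n x) = ρ (n + 1) x - x := fun n x => by
    have h : ρ (n + 1) (g n (dFromSucc d n x) - x) = g n (dFromSucc d n x) - x :=
      ρ_of_d _ _ ((dFromSucc_eq_zero_iff d n _).1 (by simp [hg]))
    rw [map_sub, sub_eq_iff_eq_add] at h
    simp only [φ, LinearMap.neg_apply, LinearMap.comp_apply, π_d, LinearMap.sub_apply,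
      LinearMap.id_apply, h]
    abel
  refine ⟨p, ι, φ, fun n => ?_, fun n => LinearMap.ext (d_ι n), fun n => LinearMap.ext (p_ι n),
    fun n => LinearMap.ext (p_φ n), fun n => LinearMap.ext fun y => φ_of_π n _ (π_ι n y),
    fun n => LinearMap.ext fun x => φ_of_π _ _ ?_, fun n => LinearMap.ext fun x => ?_⟩
  · ext x
    exact p_bdry _ _ (castL_d_mem_bdries d rfl x) (d_castL_d d hdd rfl x)
  · simp [π, ρ_φ, p_φ]
  · have h₁ := castL_comp_d_of_dFromSucc d φ (fun n => ρ n - LinearMap.id) φ_d rfl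
      (show n - 1 + 1 = n by omega) x
    refine (congrArg₂ (· + ·) h₁ (d_φ n x)).trans ?_
    simp only [π, LinearMap.sub_apply, LinearMap.comp_apply, LinearMap.id_apply]
    abel
end
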